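/- arXiv:2407.14215 — 2 statements merged into one kernel-verified Lean document; each statement's English description precedes it below -/
import Mathlib

section
/- Let q : R^n → (−∞,∞] be proper lower semicontinuous convex, F : R^n → R^n continuously differentiable and Lipschitz with modulus ℓ ≥ 0 on a ball B_r(x̄), where x̄ solves 0 ∈ F(x̄) + ∂q(x̄), and let γ > 0. Assume ∂q is SCD semismooth* at (x̄, −F(x̄)), i.e. for every ε > 0 there exists δ_q > 0 such that hypothesis (H1) holds. Then u_γ is G-semismooth at x̄ with respect to the map T_{u_γ}(x) := { B(I − γ⁻¹F'(x)) − I : B ∈ ∂_B P_{γ⁻¹q}(x − γ⁻¹F(x)) }: for every ε > 0 there is ρ > 0 such that ‖u_γ(x̂) − C(x̂ − x̄)‖ ≤ ε‖x̂ − x̄‖ for all x̂ with ‖x̂ − x̄‖ ≤ ρ and all C ∈ T_{u_γ}(x̂) (note u_γ(x̄) = 0). -/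
open Filter Metric ContinuousLinearMap Asymptotics
open scoped Topology RealInnerProductSpace

noncomputable section

abbrev Eu (n : ℕ) : Type := EuclideanSpace ℝ (Fin n)

/-- `q` is a proper lower semicontinuous convex function with values in `(-∞, ∞]`. -/
def ProperLscConvex {n : ℕ} (q : Eu n → EReal) : Prop :=
  (∀ x, q x ≠ ⊥) ∧ (∃ x, q x ≠ ⊤) ∧ LowerSemicontinuous q ∧
  (∀ x y : Eu n, ∀ a b : ℝ, 0 ≤ a → 0 ≤ b → a + b = 1 →
    q (a • x + b • y) ≤ (a : EReal) * q x + (b : EReal) * q y)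

/-- `P` is the proximal mapping `P_{γ⁻¹ q}`: `P x` is the unique minimizer of
`z ↦ q(z) + (γ/2)‖z − x‖²`. -/
def IsProxOf {n : ℕ} (q : Eu n → EReal) (γ : ℝ) (P : Eu n → Eu n) : Prop :=
  ∀ x z : Eu n,
    (q (P x) + ((γ / 2 * ‖P x - x‖^2 : ℝ) : EReal) ≤ q z + ((γ / 2 * ‖z - x‖^2 : ℝ) : EReal)) ∧
    (q z + ((γ / 2 * ‖z - x‖^2 : ℝ) : EReal) ≤ q (P x) + ((γ / 2 * ‖P x - x‖^2 : ℝ) : EReal)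
      → z = P x)

/-- The convex subdifferential `∂q(y)`. -/
def subdiff {n : ℕ} (q : Eu n → EReal) (y : Eu n) : Set (Eu n) :=
  {v | ∀ z : Eu n, q y + ((⟪v, z - y⟫ : ℝ) : EReal) ≤ q z}

/-- Bouligand subdifferential: all limits of derivatives along sequences of
differentiability points converging to `x`. -/
def BSubdiff {n m : ℕ} (Φ : Eu n → Eu m) (x : Eu n) : Set (Eu n →L[ℝ] Eu m) :=
  {V | ∃ (u : ℕ → Eu n) (Vk : ℕ → Eu n →L[ℝ] Eu m),
      (∀ k, HasFDerivAt Φ (Vk k) (u k)) ∧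
      Tendsto u atTop (𝓝 x) ∧ Tendsto Vk atTop (𝓝 V)}


lemma toReal_sub_ineq {n : ℕ} {q : Eu n → EReal} (hb : ∀ x, q x ≠ ⊥) {d v : Eu n}
    (hv : v ∈ subdiff q d) {z : Eu n} (hd : q d ≠ ⊤) (hz : q z ≠ ⊤) :
    (q d).toReal + ⟪v, z - d⟫ ≤ (q z).toReal := by
  have h := hv z
  rw [← EReal.coe_toReal hd (hb d), ← EReal.coe_toReal hz (hb z)] at h
  exact_mod_cast h

lemma subdiff_dom {n : ℕ} {q : Eu n → EReal} (hq : ProperLscConvex q) {d v : Eu n}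
    (hv : v ∈ subdiff q d) : q d ≠ ⊤ := by
  obtain ⟨hb, ⟨z, hz⟩, -, -⟩ := hq
  intro h
  have h1 := hv z
  rw [h, EReal.top_add_coe] at h1
  exact hz (top_le_iff.mp h1)

lemma subdiff_mono {n : ℕ} {q : Eu n → EReal} (hq : ProperLscConvex q) {d v e w : Eu n}
    (hv : v ∈ subdiff q d) (hw : w ∈ subdiff q e) : 0 ≤ ⟪v - w, d - e⟫ := by
  have h1 := toReal_sub_ineq hq.1 hv (subdiff_dom hq hv) (subdiff_dom hq hw)
  have h2 := toReal_sub_ineq hq.1 hw (subdiff_dom hq hw) (subdiff_dom hq hv)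
  rw [← neg_sub d e, inner_neg_right] at h1
  rw [inner_sub_left]
  linarith

lemma prox_dom {n : ℕ} {q : Eu n → EReal} (hq : ProperLscConvex q) {γ : ℝ}
    {P : Eu n → Eu n} (hP : IsProxOf q γ P) (y : Eu n) : q (P y) ≠ ⊤ := by
  obtain ⟨hb, ⟨z, hz⟩, -, -⟩ := hq
  intro h
  have h1 := (hP y z).1
  rw [h, EReal.top_add_coe, ← EReal.coe_toReal hz (hb z), ← EReal.coe_add] at h1
  exact EReal.coe_ne_top _ (top_le_iff.mp h1)

lemma prox_ineq {n : ℕ} {q : Eu n → EReal} (hq : ProperLscConvex q) {γ : ℝ}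
    {P : Eu n → Eu n} (hP : IsProxOf q γ P) (y z : Eu n) (hz : q z ≠ ⊤) :
    (q (P y)).toReal + γ / 2 * ‖P y - y‖^2 ≤ (q z).toReal + γ / 2 * ‖z - y‖^2 := by
  have h1 := (hP y z).1
  rw [← EReal.coe_toReal hz (hq.1 z),
    ← EReal.coe_toReal (prox_dom hq hP y) (hq.1 _)] at h1
  exact_mod_cast h1

lemma prox_subdiff {n : ℕ} {q : Eu n → EReal} (hq : ProperLscConvex q) {γ : ℝ} (hγ : 0 < γ)
    {P : Eu n → Eu n} (hP : IsProxOf q γ P) (y : Eu n) : γ • (y - P y) ∈ subdiff q (P y) := by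
  intro z
  by_cases hz : q z = ⊤
  · rw [hz]; exact le_top
  have hp := prox_dom hq hP y
  have key : ∀ t : ℝ, 0 < t → t ≤ 1 →
      0 ≤ ((q z).toReal - (q (P y)).toReal + γ * ⟪P y - y, z - P y⟫) + t * (γ / 2 * ‖z - P y‖^2) := by
    intro t ht ht1
    have hc := hq.2.2.2 (P y) z (1 - t) t (by linarith) ht.le (by ring)
    rw [← EReal.coe_toReal hz (hq.1 z), ← EReal.coe_toReal hp (hq.1 _), ← EReal.coe_mul,
      ← EReal.coe_mul, ← EReal.coe_add] at hc
    have hm : q ((1 - t) • P y + t • z) ≠ ⊤ := by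
      intro h
      rw [h] at hc
      exact EReal.coe_ne_top _ (top_le_iff.mp hc)
    have hi := prox_ineq hq hP y _ hm
    rw [← EReal.coe_toReal hm (hq.1 _), EReal.coe_le_coe_iff] at hc
    have e : (1 - t) • P y + t • z - y = (P y - y) + t • (z - P y) := by module
    rw [e, norm_add_sq_real, inner_smul_right, norm_smul, mul_pow, Real.norm_eq_abs, sq_abs] at hi
    have : 0 ≤ t * (((q z).toReal - (q (P y)).toReal + γ * ⟪P y - y, z - P y⟫)
        + t * (γ / 2 * ‖z - P y‖^2)) := by nlinarith
    exact nonneg_of_mul_nonneg_right this ht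
  have hlim : 0 ≤ (q z).toReal - (q (P y)).toReal + γ * ⟪P y - y, z - P y⟫ := by
    have ht : Tendsto (fun t : ℝ => ((q z).toReal - (q (P y)).toReal + γ * ⟪P y - y, z - P y⟫)
        + t * (γ / 2 * ‖z - P y‖^2)) (𝓝[>] 0)
        (𝓝 (((q z).toReal - (q (P y)).toReal + γ * ⟪P y - y, z - P y⟫)
        + 0 * (γ / 2 * ‖z - P y‖^2))) := by
      apply Tendsto.mono_left _ nhdsWithin_le_nhds
      apply Continuous.tendsto
      fun_prop
    rw [zero_mul, add_zero] at ht
    refine ge_of_tendsto ht ?_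
    filter_upwards [Ioc_mem_nhdsGT (zero_lt_one' ℝ)] with t h
    exact key t h.1 h.2
  rw [← EReal.coe_toReal hz (hq.1 z), ← EReal.coe_toReal hp (hq.1 _), ← EReal.coe_add,
    EReal.coe_le_coe_iff, inner_smul_left, ← neg_sub (P y) y, inner_neg_left]
  simp only [conj_trivial]
  linarith

/-- Points of the graph of the subdifferential are fixed through the prox, nonexpansively. -/
lemma prox_nonexp_gen {n : ℕ} {q : Eu n → EReal} (hq : ProperLscConvex q) {γ : ℝ} (hγ : 0 < γ)
    {a b p s : Eu n} (h1 : γ • (a - p) ∈ subdiff q p) (h2 : γ • (b - s) ∈ subdiff q s) :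
    ‖p - s‖ ≤ ‖a - b‖ := by
  have h := subdiff_mono hq h1 h2
  rw [← smul_sub, inner_smul_left] at h
  simp only [conj_trivial] at h
  have h' := nonneg_of_mul_nonneg_right h hγ
  rw [show a - p - (b - s) = (a - b) - (p - s) by abel, inner_sub_left,
    real_inner_self_eq_norm_sq] at h'
  have h3 := real_inner_le_norm (a - b) (p - s)
  by_contra hlt
  push Not at hlt
  nlinarith [norm_nonneg (a - b), norm_nonneg (p - s)]

/-- The potential of the prox. -/
def psiPot {n : ℕ} (q : Eu n → EReal) (γ : ℝ) (P : Eu n → Eu n) (y : Eu n) : ℝ :=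
  γ / 2 * ‖y‖^2 - ((q (P y)).toReal + γ / 2 * ‖P y - y‖^2)

lemma psiPot_ineq {n : ℕ} {q : Eu n → EReal} (hq : ProperLscConvex q) {γ : ℝ}
    {P : Eu n → Eu n} (hP : IsProxOf q γ P) (y x : Eu n) :
    psiPot q γ P y + γ * ⟪P y, x - y⟫ ≤ psiPot q γ P x := by
  have h := prox_ineq hq hP x (P y) (prox_dom hq hP y)
  unfold psiPot
  have e1 := norm_sub_sq_real (P y) x
  have e2 := norm_sub_sq_real (P y) y
  rw [e1] at h
  rw [e2, inner_sub_right]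
  nlinarith

lemma psiPot_deriv {n : ℕ} {q : Eu n → EReal} (hq : ProperLscConvex q) {γ : ℝ} (hγ : 0 < γ)
    {P : Eu n → Eu n} (hP : IsProxOf q γ P) (y : Eu n) :
    HasFDerivAt (psiPot q γ P) (γ • innerSL ℝ (P y)) y := by
  rw [hasFDerivAt_iff_isLittleO]
  have hO : (fun x => psiPot q γ P x - psiPot q γ P y - (γ • innerSL ℝ (P y)) (x - y))
      =O[𝓝 y] fun x => ‖x - y‖^2 := by
    refine IsBigO.of_bound γ (Eventually.of_forall fun x => ?_)
    have h1 := psiPot_ineq hq hP y x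
    have h2 := psiPot_ineq hq hP x y
    have h3 := prox_nonexp_gen hq hγ (prox_subdiff hq hγ hP x) (prox_subdiff hq hγ hP y)
    have h4 := real_inner_le_norm (P x - P y) (x - y)
    have h5 : ‖P x - P y‖ * ‖x - y‖ ≤ ‖x - y‖ * ‖x - y‖ := by gcongr
    rw [← neg_sub x y, inner_neg_right] at h2
    rw [inner_sub_left] at h4
    have e : (γ • innerSL ℝ (P y)) (x - y) = γ * ⟪P y, x - y⟫ := by simp
    rw [e, Real.norm_eq_abs, abs_of_nonneg (by linarith), norm_pow, norm_norm]
    nlinarith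
  refine hO.trans_isLittleO ?_
  have : (fun x : Eu n => ‖x - y‖^2) =o[𝓝 y] fun x => ‖x - y‖ := by
    have := (isLittleO_norm_pow_id (E' := Eu n) (n := 2) (by norm_num)).norm_right.comp_tendsto
      (show Tendsto (fun x : Eu n => x - y) (𝓝 y) (𝓝 0) by
        have : Tendsto (fun x : Eu n => x - y) (𝓝 y) (𝓝 (y - y)) :=
          (by fun_prop : Continuous fun x : Eu n => x - y).tendsto y
        simpa using this)
    exact this
  exact this.of_norm_right

lemma prox_fderiv_symm {n : ℕ} {q : Eu n → EReal} (hq : ProperLscConvex q) {γ : ℝ} (hγ : 0 < γ)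
    {P : Eu n → Eu n} (hP : IsProxOf q γ P) {y : Eu n} {V : Eu n →L[ℝ] Eu n}
    (hV : HasFDerivAt P V y) (a b : Eu n) : ⟪V a, b⟫ = ⟪V b, a⟫ := by
  have h2 : HasFDerivAt (fun x => γ • innerSL ℝ (P x)) (γ • (innerSL ℝ).comp V) y :=
    (((innerSL ℝ).hasFDerivAt (x := P y)).comp y hV).const_smul γ
  have := second_derivative_symmetric (𝕜 := ℝ) (fun x => psiPot_deriv hq hγ hP x) h2 a b
  have h : γ * ⟪V a, b⟫ = γ * ⟪V b, a⟫ := by simpa using this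
  exact mul_left_cancel₀ hγ.ne' h

lemma bsub_symm {n : ℕ} {q : Eu n → EReal} (hq : ProperLscConvex q) {γ : ℝ} (hγ : 0 < γ)
    {P : Eu n → Eu n} (hP : IsProxOf q γ P) {y : Eu n} {B : Eu n →L[ℝ] Eu n}
    (hB : B ∈ BSubdiff P y) (a b : Eu n) : ⟪B a, b⟫ = ⟪B b, a⟫ := by
  obtain ⟨u, Vk, hd, -, hV⟩ := hB
  have t : ∀ a b : Eu n, Tendsto (fun k => ⟪Vk k a, b⟫) atTop (𝓝 ⟪B a, b⟫) := fun a b =>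
    ((by fun_prop : Continuous fun V : Eu n →L[ℝ] Eu n => ⟪V a, b⟫).tendsto B).comp hV
  refine tendsto_nhds_unique (t a b) ?_
  refine (t b a).congr fun k => ?_
  exact prox_fderiv_symm hq hγ hP (hd k) b a

lemma bsub_norm {n : ℕ} {q : Eu n → EReal} (hq : ProperLscConvex q) {γ : ℝ} (hγ : 0 < γ)
    {P : Eu n → Eu n} (hP : IsProxOf q γ P) {y : Eu n} {B : Eu n →L[ℝ] Eu n}
    (hB : B ∈ BSubdiff P y) : ‖B‖ ≤ 1 := by
  obtain ⟨u, Vk, hd, -, hV⟩ := hB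
  refine le_of_tendsto hV.norm (Eventually.of_forall fun k => ?_)
  have hL : LipschitzWith 1 P := LipschitzWith.of_dist_le_mul fun x y => by
    simpa [dist_eq_norm] using
      prox_nonexp_gen hq hγ (prox_subdiff hq hγ hP x) (prox_subdiff hq hγ hP y)
  simpa using (hd k).le_of_lipschitz hL

lemma goal_alg {n : ℕ} (B A : Eu n →L[ℝ] Eu n) (d x b f : Eu n) (c : ℝ) :
    (d - x) - (B * (1 - c • A) - 1) (x - b) =
      (d - b - B ((x - b) - c • f)) - c • B (f - A (x - b)) := by
  have e : (B * (1 - c • A) - 1) (x - b) = B ((x - b) - c • A (x - b)) - (x - b) := rfl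
  rw [e]
  generalize A (x - b) = g
  simp only [map_sub, map_smul]
  module

set_option maxHeartbeats 1000000 in
/-- Corollary 5.4: if `∂q` is SCD semismooth* at `(x̄, −F(x̄))` (hypothesis
(H1) for every `ε > 0`), then the proximal residual `u_γ` is G-semismooth at `x̄` with
respect to `T_{u_γ}(x) = {B(I − γ⁻¹F'(x)) − I : B ∈ ∂_B P_{γ⁻¹q}(x − γ⁻¹F(x))}`. -/
theorem stmt9 {n : ℕ} (q : Eu n → EReal) (hq : ProperLscConvex q)
    (γ : ℝ) (hγ : 0 < γ) (P : Eu n → Eu n) (hP : IsProxOf q γ P)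
    (F : Eu n → Eu n) (hF : ContDiff ℝ 1 F)
    (xbar : Eu n) (hsol : -F xbar ∈ subdiff q xbar)
    (r : ℝ) (hr : 0 < r) (ℓ : ℝ) (hℓ : 0 ≤ ℓ)
    (hLip : ∀ x ∈ Metric.closedBall xbar r, ∀ y ∈ Metric.closedBall xbar r,
      ‖F x - F y‖ ≤ ℓ * ‖x - y‖)
    (hSS : ∀ ε > (0:ℝ), ∃ δq > (0:ℝ),
      ∀ d dstar : Eu n, dstar ∈ subdiff q d →
        Real.sqrt (‖d - xbar‖^2 + ‖dstar + F xbar‖^2) ≤ δq →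
        ∀ B ∈ BSubdiff P (d + γ⁻¹ • dstar), ∀ v : Eu n,
          |⟪γ • (v - B v), d - xbar⟫ - ⟪B v, dstar + F xbar⟫| ≤
            ε / (2 * Real.sqrt 2 * (ℓ + 1)) *
              Real.sqrt (‖B v‖^2 + ‖γ • (v - B v)‖^2) *
              Real.sqrt (‖d - xbar‖^2 + ‖dstar + F xbar‖^2)) :
    ∀ ε > (0:ℝ), ∃ ρ > (0:ℝ), ∀ xh : Eu n, ‖xh - xbar‖ ≤ ρ →
      ∀ B ∈ BSubdiff P (xh - γ⁻¹ • F xh),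
        ‖(P (xh - γ⁻¹ • F xh) - xh) -
            (B * (1 - γ⁻¹ • fderiv ℝ F xh) - 1) (xh - xbar)‖ ≤ ε * ‖xh - xbar‖ := by
  intro ε hε
  set K : ℝ := (1 + 2 * γ) * (1 + γ⁻¹ * ℓ) with hK
  have hγi : 0 < γ⁻¹ := inv_pos.mpr hγ
  have hL0 : 0 ≤ γ⁻¹ * ℓ := by positivity
  have hKpos : 0 < K := by positivity
  have hs2 : 0 < Real.sqrt 2 := by positivity
  set η : ℝ := γ * (ε / 2) / ((1 + 2 * γ) * K) with hη
  have hηpos : 0 < η := by positivity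
  obtain ⟨δq, hδq, hS⟩ := hSS (η * (2 * Real.sqrt 2 * (ℓ + 1))) (by positivity)
  rw [mul_div_assoc, div_self (by positivity), mul_one] at hS
  -- smoothness of F
  have hFd : ∀ᶠ x in 𝓝 xbar,
      ‖F x - F xbar - fderiv ℝ F x (x - xbar)‖ ≤ γ * (ε / 2) * ‖x - xbar‖ := by
    have hd : HasFDerivAt F (fderiv ℝ F xbar) xbar :=
      ((hF.differentiable (by norm_num)) xbar).hasFDerivAt
    have h1 := (hasFDerivAt_iff_isLittleO.mp hd).bound
      (show 0 < γ * (ε / 4) by positivity)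
    have hc : Continuous (fderiv ℝ F) := hF.continuous_fderiv (by norm_num)
    have h2 : ∀ᶠ x in 𝓝 xbar, ‖fderiv ℝ F x - fderiv ℝ F xbar‖ < γ * (ε / 4) := by
      have := Metric.tendsto_nhds.mp (hc.tendsto xbar) (γ * (ε / 4)) (by positivity)
      simpa [dist_eq_norm] using this
    filter_upwards [h1, h2] with x h1 h2
    have e : F x - F xbar - fderiv ℝ F x (x - xbar) =
        (F x - F xbar - fderiv ℝ F xbar (x - xbar))
          - (fderiv ℝ F x - fderiv ℝ F xbar) (x - xbar) := by
      rw [sub_apply]; abel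
    have h3 := (fderiv ℝ F x - fderiv ℝ F xbar).le_of_opNorm_le h2.le (x - xbar)
    rw [e]
    refine (norm_sub_le _ _).trans ?_
    linarith
  obtain ⟨ρ1, hρ1, hF1⟩ := Metric.eventually_nhds_iff.mp hFd
  refine ⟨min (min r (ρ1 / 2)) (δq / K), by positivity, fun xh hx B hB => ?_⟩
  have hxr : ‖xh - xbar‖ ≤ r := hx.trans ((min_le_left _ _).trans (min_le_left _ _))
  have hxρ : ‖xh - xbar‖ ≤ ρ1 / 2 := hx.trans ((min_le_left _ _).trans (min_le_right _ _))
  have hxδ : ‖xh - xbar‖ ≤ δq / K := hx.trans (min_le_right _ _)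
  have hFx := hF1 (y := xh) (by rw [dist_eq_norm]; linarith)
  have hLx := hLip xh (by simpa [dist_eq_norm] using hxr) xbar (by simp [hr.le])
  have hB1 := bsub_norm hq hγ hP hB
  have hBs := bsub_symm hq hγ hP hB
  have hBv : ∀ v, ‖B v‖ ≤ ‖v‖ := fun v => by simpa using B.le_of_opNorm_le hB1 v
  set y := xh - γ⁻¹ • F xh with hy
  set d := P y with hd
  set z : Eu n := (xh - xbar) - γ⁻¹ • (F xh - F xbar) with hz
  have hsub := prox_subdiff hq hγ hP y
  have hsol' : γ • ((xbar - γ⁻¹ • F xbar) - xbar) ∈ subdiff q xbar := by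
    have : γ • ((xbar - γ⁻¹ • F xbar) - xbar) = - F xbar := by
      rw [sub_sub_cancel_left, smul_neg, smul_inv_smul₀ hγ.ne']
    rwa [this]
  have hyz : y - (xbar - γ⁻¹ • F xbar) = z := by rw [hy, hz, smul_sub]; abel
  have hdx : ‖d - xbar‖ ≤ ‖z‖ := by
    rw [← hyz]; exact prox_nonexp_gen hq hγ hsub hsol'
  have hzn : ‖z‖ ≤ (1 + γ⁻¹ * ℓ) * ‖xh - xbar‖ := by
    refine (norm_sub_le _ _).trans ?_
    rw [norm_smul, Real.norm_of_nonneg hγi.le]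
    have := mul_le_mul_of_nonneg_left hLx hγi.le
    linarith
  have hds : γ • (y - d) + F xbar = γ • (z - (d - xbar)) := by
    rw [← hyz]
    have : F xbar = γ • (γ⁻¹ • F xbar) := (smul_inv_smul₀ hγ.ne' _).symm
    nth_rewrite 1 [this]
    module
  have hdsn : ‖γ • (y - d) + F xbar‖ ≤ 2 * γ * ‖z‖ := by
    rw [hds, norm_smul, Real.norm_of_nonneg hγ.le]
    have := norm_sub_le z (d - xbar)
    nlinarith
  have sq : ∀ a b c : ℝ, 0 ≤ a → 0 ≤ b → 0 ≤ c → a ≤ c → b ≤ 2 * γ * c →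
      Real.sqrt (a^2 + b^2) ≤ (1 + 2 * γ) * c := by
    intro a b c ha hb hc h1 h2
    apply Real.sqrt_le_iff.mpr
    refine ⟨by positivity, ?_⟩
    have : a + b ≤ (1 + 2 * γ) * c := by linarith
    have h3 := pow_le_pow_left₀ (by positivity) this 2
    nlinarith [mul_nonneg ha hb]
  have hpair : Real.sqrt (‖d - xbar‖^2 + ‖γ • (y - d) + F xbar‖^2) ≤ K * ‖xh - xbar‖ := by
    refine (sq _ _ _ (norm_nonneg _) (norm_nonneg _) (norm_nonneg z) hdx hdsn).trans ?_
    rw [hK, mul_assoc]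
    gcongr
  have hpδ : K * ‖xh - xbar‖ ≤ δq := by
    rw [le_div_iff₀ hKpos] at hxδ; linarith
  have hyd : d + γ⁻¹ • (γ • (y - d)) = y := by
    rw [inv_smul_smul₀ hγ.ne']; abel
  set w : Eu n := d - xbar - B z with hw
  have hS1 := hS d (γ • (y - d)) hsub (hpair.trans hpδ) B (by rw [hyd]; exact hB) w
  have hlhs : ⟪γ • (w - B w), d - xbar⟫ - ⟪B w, γ • (y - d) + F xbar⟫ = γ * ‖w‖^2 := by
    rw [hds, inner_smul_left, inner_smul_right, inner_sub_left, inner_sub_right (B w) z (d - xbar), hBs w z,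
      ← real_inner_self_eq_norm_sq w]
    simp only [conj_trivial]
    have : ⟪w, w⟫ = ⟪w, d - xbar⟫ - ⟪B z, w⟫ := by
      rw [real_inner_comm w (B z), ← inner_sub_right]
    rw [this]; ring
  have hev : Real.sqrt (‖B w‖^2 + ‖γ • (w - B w)‖^2) ≤ (1 + 2 * γ) * ‖w‖ := by
    refine sq _ _ _ (norm_nonneg _) (norm_nonneg _) (norm_nonneg w) (hBv w) ?_
    rw [norm_smul, Real.norm_of_nonneg hγ.le]
    have := norm_sub_le w (B w)
    nlinarith [hBv w]
  have hmain : γ * ‖w‖^2 ≤ γ * (ε / 2) * ‖w‖ * ‖xh - xbar‖ := by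
    rw [hlhs] at hS1
    calc γ * ‖w‖^2 ≤ _ := le_abs_self _
      _ ≤ _ := hS1
      _ ≤ η * ((1 + 2 * γ) * ‖w‖) * (K * ‖xh - xbar‖) := by gcongr
      _ = η * ((1 + 2 * γ) * K) * ‖w‖ * ‖xh - xbar‖ := by ring
      _ = _ := by rw [hη, div_mul_cancel₀ _ (by positivity)]
  have hwn : ‖w‖ ≤ ε / 2 * ‖xh - xbar‖ := by
    rcases (norm_nonneg w).eq_or_lt with h | h
    · rw [← h]; positivity
    · have : (γ * ‖w‖) * ‖w‖ ≤ (γ * ‖w‖) * (ε / 2 * ‖xh - xbar‖) := by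
        calc (γ * ‖w‖) * ‖w‖ = γ * ‖w‖^2 := by ring
          _ ≤ _ := hmain
          _ = _ := by ring
      exact le_of_mul_le_mul_left this (by positivity)
  have hgoal : (d - xh) - (B * (1 - γ⁻¹ • fderiv ℝ F xh) - 1) (xh - xbar) =
      w - γ⁻¹ • B (F xh - F xbar - fderiv ℝ F xh (xh - xbar)) := by
    exact goal_alg B (fderiv ℝ F xh) d xh xbar (F xh - F xbar) γ⁻¹
  rw [hgoal]
  refine (norm_sub_le _ _).trans ?_
  rw [norm_smul, Real.norm_of_nonneg hγi.le]
  have h1 := mul_le_mul_of_nonneg_left ((hBv _).trans hFx) hγi.le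
  have h2 : γ⁻¹ * (γ * (ε / 2) * ‖xh - xbar‖) = ε / 2 * ‖xh - xbar‖ := by
    field_simp
  linarith
end
end

section
/- Let q : R^n → (−∞,∞] be proper lower semicontinuous convex, F : R^n → R^n continuously differentiable and Lipschitz with modulus ℓ ≥ 0 on a ball B_r(x̄), where x̄ solves 0 ∈ F(x̄) + ∂q(x̄), and let 0 < γ̲ ≤ γ̄. Under assumptions (i) and (ii) (SCD semismoothness* of ∂q at (x̄, −F(x̄)) expressed by hypothesis (H1), and the uniform invertibility/boundedness condition with constants κ, ρ), there exists a neighborhood U of x̄ such that for every x⁰ ∈ U, any sequence generated by the implementable SCD semismooth* Newton method—x^{k+1} = x^k + Δx^k with γ^k ∈ [γ̲, γ̄], u^k := u_{γ^k}(x^k), B^k ∈ ∂_B P_{(γ^k)⁻¹q}(x^k − (γ^k)⁻¹F(x^k)), W^k invertible, Y^{*k} := B^kW^k, X^{*k} := γ^k(I − B^k)W^k, and (Y^{*k}ᵀF'(x^k) + X^{*k}ᵀ)Δx^k = (γ^kY^{*k}ᵀ + X^{*k}ᵀ)u^k—coincides with a sequence generated by the G-semismooth Newton iteration (B^k(I −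 (γ^k)⁻¹F'(x^k)) − I)Δx^k = −u^k and converges superlinearly to x̄. -/
open Filter Metric ContinuousLinearMap Asymptotics
open scoped Topology RealInnerProductSpace

noncomputable section

set_option maxHeartbeats 1000000

theorem ne_top_of_sub {n : ℕ} {q : Eu n → EReal} (hq : ProperLscConvex q) {a v : Eu n}
    (h : v ∈ subdiff q a) : ∃ r : ℝ, q a = r := by
  obtain ⟨h1, ⟨x, hx⟩, -, -⟩ := hq
  have ht : q a ≠ ⊤ := by
    intro ht
    have := h x
    rw [ht, EReal.top_add_coe] at this
    exact hx (top_le_iff.mp this)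
  exact ⟨(q a).toReal, (EReal.coe_toReal ht (h1 a)).symm⟩

theorem sub_mono {n : ℕ} {q : Eu n → EReal} (hq : ProperLscConvex q) {a b v w : Eu n}
    (h : v ∈ subdiff q a) (h' : w ∈ subdiff q b) : 0 ≤ ⟪v - w, a - b⟫ := by
  obtain ⟨ra, ha⟩ := ne_top_of_sub hq h
  obtain ⟨rb, hb⟩ := ne_top_of_sub hq h'
  have e1 := h b
  have e2 := h' a
  rw [ha, hb] at e1 e2
  norm_cast at e1 e2
  rw [inner_sub_left, ← neg_sub b a, inner_neg_right]
  rw [← neg_sub b a, inner_neg_right] at e2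
  have : ⟪w, -(b - a)⟫ = -⟪w, b - a⟫ := inner_neg_right _ _
  linarith

theorem prox_fin {n : ℕ} {q : Eu n → EReal} (hq : ProperLscConvex q) {γ : ℝ}
    {p : Eu n → Eu n} (hp : IsProxOf q γ p) (x : Eu n) : ∃ r : ℝ, q (p x) = r := by
  obtain ⟨h1, ⟨y, hy⟩, -, -⟩ := hq
  have ht : q (p x) ≠ ⊤ := by
    intro ht
    have := (hp x y).1
    rw [ht, EReal.top_add_coe, ← EReal.coe_toReal hy (h1 y)] at this
    norm_cast at this
  exact ⟨(q (p x)).toReal, (EReal.coe_toReal ht (h1 _)).symm⟩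

theorem prox_sub {n : ℕ} {q : Eu n → EReal} (hq : ProperLscConvex q) {γ : ℝ} (hγ : 0 < γ)
    {p : Eu n → Eu n} (hp : IsProxOf q γ p) (x : Eu n) :
    γ • (x - p x) ∈ subdiff q (p x) := by
  intro z
  obtain ⟨r, hr⟩ := prox_fin hq hp x
  by_cases hz : q z = ⊤
  · rw [hz]; exact le_top
  have hzr := EReal.coe_toReal hz (hq.1 z)
  set s := (q z).toReal
  rw [hr, ← hzr]
  norm_cast
  have key : ∀ t : ℝ, 0 < t → t ≤ 1 →
      r + ⟪γ • (x - p x), z - p x⟫ ≤ s + t * (γ / 2 * ‖z - p x‖ ^ 2) := by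
    intro t ht ht1
    have h1 := (hp x ((1 - t) • p x + t • z)).1
    have h2 := hq.2.2.2 (p x) z (1 - t) t (by linarith) ht.le (by ring)
    have h3 := h1.trans (add_le_add_left h2 _)
    rw [hr, ← hzr] at h3
    norm_cast at h3
    have e : (1 - t) • p x + t • z - x = (p x - x) + t • (z - p x) := by module
    rw [e, norm_add_sq_real, norm_smul, inner_smul_right, mul_pow, Real.norm_eq_abs, sq_abs] at h3
    have e2 : ⟪γ • (x - p x), z - p x⟫ = - γ * ⟪p x - x, z - p x⟫ := by
      rw [← neg_sub (p x) x, smul_neg, inner_neg_left, inner_smul_left]; simp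
    rw [e2]
    have : t * (r + - γ * ⟪p x - x, z - p x⟫) ≤ t * (s + t * (γ / 2 * ‖z - p x‖ ^ 2)) := by
      nlinarith
    exact le_of_mul_le_mul_left this ht
  have hlim : Tendsto (fun t : ℝ => s + t * (γ / 2 * ‖z - p x‖ ^ 2)) (𝓝[>] 0) (𝓝 s) := by
    have : Continuous (fun t : ℝ => s + t * (γ / 2 * ‖z - p x‖ ^ 2)) := by fun_prop
    have := this.tendsto 0
    simp only [zero_mul, add_zero] at this
    exact this.mono_left nhdsWithin_le_nhds
  refine ge_of_tendsto hlim ?_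
  filter_upwards [Ioc_mem_nhdsGT (zero_lt_one' ℝ)] with t ht
  exact key t ht.1 ht.2

theorem prox_eq {n : ℕ} {q : Eu n → EReal} (hq : ProperLscConvex q) {γ : ℝ} (hγ : 0 < γ)
    {p : Eu n → Eu n} (hp : IsProxOf q γ p) {d ds : Eu n} (h : ds ∈ subdiff q d) :
    p (d + γ⁻¹ • ds) = d := by
  obtain ⟨r, hr⟩ := ne_top_of_sub hq h
  have hm := sub_mono hq h (prox_sub hq hγ hp (d + γ⁻¹ • ds))
  set y := p (d + γ⁻¹ • ds)
  have e : ds - γ • (d + γ⁻¹ • ds - y) = - (γ • (d - y)) := by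
    rw [smul_sub, smul_add, smul_inv_smul₀ hγ.ne', smul_sub]; abel
  rw [e, inner_neg_left, inner_smul_left, real_inner_self_eq_norm_sq] at hm
  simp only [conj_trivial] at hm
  have : ‖d - y‖ ^ 2 ≤ 0 := by
    by_contra hc
    push Not at hc
    have := mul_pos hγ hc
    linarith
  have h0 : ‖d - y‖ = 0 := by nlinarith [norm_nonneg (d - y)]
  exact (sub_eq_zero.mp (norm_eq_zero.mp h0)).symm

theorem prox_firm {n : ℕ} {q : Eu n → EReal} (hq : ProperLscConvex q) {γ : ℝ} (hγ : 0 < γ)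
    {p : Eu n → Eu n} (hp : IsProxOf q γ p) (x y : Eu n) :
    ‖p x - p y‖ ^ 2 ≤ ⟪p x - p y, x - y⟫ := by
  have hm := sub_mono hq (prox_sub hq hγ hp x) (prox_sub hq hγ hp y)
  have e : γ • (x - p x) - γ • (y - p y) = γ • ((x - y) - (p x - p y)) := by module
  rw [e, inner_smul_left, inner_sub_left, real_inner_self_eq_norm_sq, real_inner_comm] at hm
  simp only [conj_trivial] at hm
  have := nonneg_of_mul_nonneg_right hm hγ
  linarith

theorem prox_lip {n : ℕ} {q : Eu n → EReal} (hq : ProperLscConvex q) {γ : ℝ} (hγ : 0 < γ)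
    {p : Eu n → Eu n} (hp : IsProxOf q γ p) (x y : Eu n) :
    ‖p x - p y‖ ≤ ‖x - y‖ := by
  have h := prox_firm hq hγ hp x y
  have h2 := real_inner_le_norm (p x - p y) (x - y)
  by_contra hc
  push Not at hc
  nlinarith [norm_nonneg (x - y), norm_nonneg (p x - p y)]

theorem prox_cont {n : ℕ} {q : Eu n → EReal} (hq : ProperLscConvex q) {γ : ℝ} (hγ : 0 < γ)
    {p : Eu n → Eu n} (hp : IsProxOf q γ p) : Continuous p := by
  have : LipschitzWith 1 p := LipschitzWith.of_dist_le_mul (fun x y => by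
    rw [dist_eq_norm, dist_eq_norm]; simpa using prox_lip hq hγ hp x y)
  exact this.continuous

theorem deriv_firm {n : ℕ} {q : Eu n → EReal} (hq : ProperLscConvex q) {γ : ℝ} (hγ : 0 < γ)
    {p : Eu n → Eu n} (hp : IsProxOf q γ p) {x : Eu n} {V : Eu n →L[ℝ] Eu n}
    (hV : HasFDerivAt p V x) (v : Eu n) : ‖V v‖ ^ 2 ≤ ⟪V v, v⟫ := by
  have h := hV.lim_real v
  refine le_of_tendsto_of_tendsto (h.norm.pow 2) (h.inner tendsto_const_nhds) ?_
  filter_upwards [eventually_gt_atTop 0] with c hc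
  have := prox_firm hq hγ hp (x + c⁻¹ • v) x
  rw [add_sub_cancel_left, inner_smul_right] at this
  rw [norm_smul, mul_pow, inner_smul_left, Real.norm_eq_abs, sq_abs]
  simp only [conj_trivial]
  calc _ ≤ c ^ 2 * (c⁻¹ * ⟪p (x + c⁻¹ • v) - p x, v⟫) := by gcongr
    _ = _ := by field_simp

theorem env_grad {n : ℕ} {q : Eu n → EReal} (hq : ProperLscConvex q) {γ : ℝ} (hγ : 0 < γ)
    {p : Eu n → Eu n} (hp : IsProxOf q γ p) (x : Eu n) :
    HasFDerivAt (fun y => (q (p y)).toReal + γ / 2 * ‖p y - y‖ ^ 2)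
      (innerSL ℝ (γ • (x - p x))) x := by
  set e : Eu n → ℝ := fun y => (q (p y)).toReal + γ / 2 * ‖p y - y‖ ^ 2 with he
  have hup : ∀ x y, e y - e x ≤ γ * ⟪x - p x, y - x⟫ + γ / 2 * ‖y - x‖ ^ 2 := by
    intro x y
    obtain ⟨r, hr⟩ := prox_fin hq hp x
    obtain ⟨s, hs⟩ := prox_fin hq hp y
    have h := (hp y (p x)).1
    rw [hr, hs] at h
    norm_cast at h
    have e1 : p x - y = -((x - p x) + (y - x)) := by abel
    have e3 : p x - x = -(x - p x) := by abel
    rw [e1, norm_neg, norm_add_sq_real] at h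
    simp only [he, hr, hs, EReal.toReal_coe]
    rw [e3, norm_neg]
    nlinarith
  have hmono : ∀ x y, ⟪x - p x, y - x⟫ ≤ ⟪y - p y, y - x⟫ := by
    intro x y
    have h1 := prox_lip hq hγ hp y x
    have h2 := real_inner_le_norm (p y - p x) (y - x)
    have e1 : ⟪y - p y, y - x⟫ - ⟪x - p x, y - x⟫ = ‖y - x‖ ^ 2 - ⟪p y - p x, y - x⟫ := by
      rw [← inner_sub_left, ← real_inner_self_eq_norm_sq, ← inner_sub_left]; congr 1; abel
    nlinarith [norm_nonneg (y - x)]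
  apply HasFDerivAt.of_isLittleO
  have hO : (fun y => e y - e x - innerSL ℝ (γ • (x - p x)) (y - x)) =O[𝓝 x]
      (fun y => ‖y - x‖ ^ 2) := by
    refine IsBigO.of_bound (γ / 2) (Eventually.of_forall fun y => ?_)
    rw [innerSL_apply_apply, inner_smul_left]
    simp only [conj_trivial, Real.norm_eq_abs, abs_pow, abs_norm]
    have h1 := hup x y
    have h2 := hup y x
    have h3 := hmono x y
    have e1 : ⟪y - p y, x - y⟫ = -⟪y - p y, y - x⟫ := by
      rw [← neg_sub y x, inner_neg_right]
    rw [e1, norm_sub_rev] at h2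
    rw [abs_le]
    constructor <;> nlinarith
  refine hO.trans_isLittleO ?_
  have := (isLittleO_norm_pow_id (E' := Eu n) (one_lt_two)).comp_tendsto
    (k := fun y => y - x) (l' := 𝓝 x) (by
      have : Continuous fun y : Eu n => y - x := by fun_prop
      simpa using this.tendsto x)
  exact this

theorem deriv_symm {n : ℕ} {q : Eu n → EReal} (hq : ProperLscConvex q) {γ : ℝ} (hγ : 0 < γ)
    {p : Eu n → Eu n} (hp : IsProxOf q γ p) {x : Eu n} {V : Eu n →L[ℝ] Eu n}
    (hV : HasFDerivAt p V x) (v w : Eu n) : ⟪V v, w⟫ = ⟪v, V w⟫ := by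
  have h2 : HasFDerivAt (fun y => innerSL ℝ (γ • (y - p y)))
      ((innerSL ℝ : Eu n →L[ℝ] Eu n →L[ℝ] ℝ).comp
        (γ • (ContinuousLinearMap.id ℝ (Eu n) - V))) x :=
    (innerSL ℝ : Eu n →L[ℝ] Eu n →L[ℝ] ℝ).hasFDerivAt.comp x
      (((hasFDerivAt_id x).sub hV).const_smul γ)
  have := second_derivative_symmetric (fun y => env_grad hq hγ hp y) h2 v w
  simp only [ContinuousLinearMap.comp_apply, innerSL_apply_apply, _root_.smul_apply,
    _root_.sub_apply, ContinuousLinearMap.id_apply, inner_smul_left, inner_sub_left,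
    conj_trivial] at this
  have := mul_left_cancel₀ hγ.ne' this
  rw [real_inner_comm v w] at this
  rw [real_inner_comm (V w) v]
  linarith

theorem B_firm {n : ℕ} {q : Eu n → EReal} (hq : ProperLscConvex q) {γ : ℝ} (hγ : 0 < γ)
    {p : Eu n → Eu n} (hp : IsProxOf q γ p) {x : Eu n} {B : Eu n →L[ℝ] Eu n}
    (hB : B ∈ BSubdiff p x) (v : Eu n) : ‖B v‖ ^ 2 ≤ ⟪B v, v⟫ := by
  obtain ⟨u, V, hV, -, hlim⟩ := hB
  have h := ((ContinuousLinearMap.apply ℝ (Eu n) v).continuous.tendsto B).comp hlim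
  exact le_of_tendsto_of_tendsto (h.norm.pow 2) (h.inner tendsto_const_nhds)
    (Eventually.of_forall fun k => deriv_firm hq hγ hp (hV k) v)

theorem B_symm {n : ℕ} {q : Eu n → EReal} (hq : ProperLscConvex q) {γ : ℝ} (hγ : 0 < γ)
    {p : Eu n → Eu n} (hp : IsProxOf q γ p) {x : Eu n} {B : Eu n →L[ℝ] Eu n}
    (hB : B ∈ BSubdiff p x) (v w : Eu n) : ⟪B v, w⟫ = ⟪v, B w⟫ := by
  obtain ⟨u, V, hV, -, hlim⟩ := hB
  have h := ((ContinuousLinearMap.apply ℝ (Eu n) v).continuous.tendsto B).comp hlim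
  have h' := ((ContinuousLinearMap.apply ℝ (Eu n) w).continuous.tendsto B).comp hlim
  refine tendsto_nhds_unique (h.inner (tendsto_const_nhds (x := w))) ?_
  refine ((tendsto_const_nhds (x := v)).inner h').congr fun k => ?_
  exact (deriv_symm hq hγ hp (hV k) v w).symm

theorem T_unit {n : ℕ} {c : ℝ} (hc : 0 < c) {B : Eu n →L[ℝ] Eu n}
    (hB : ∀ v, ‖B v‖ ^ 2 ≤ ⟪B v, v⟫) : IsUnit (B + c • (1 - B)) := by
  rw [ContinuousLinearMap.isUnit_iff_bijective]
  have hinj : Function.Injective (B + c • (1 - B) : Eu n →L[ℝ] Eu n) := by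
    rw [injective_iff_map_eq_zero]
    intro v hv
    have hv' : B v + c • (v - B v) = 0 := by simpa using hv
    have h1 : ⟪B v, B v + c • (v - B v)⟫ = 0 := by rw [hv', inner_zero_right]
    rw [inner_add_right, inner_smul_right, inner_sub_right, real_inner_self_eq_norm_sq] at h1
    have h2 := hB v
    have h3 := mul_nonneg hc.le (sub_nonneg.mpr h2)
    have h4 : ‖B v‖ = 0 := by nlinarith [norm_nonneg (B v)]
    have h5 := norm_eq_zero.mp h4
    rw [h5, zero_add, sub_zero] at hv'
    exact (smul_eq_zero.mp hv').resolve_left hc.ne'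
  exact ⟨hinj, (LinearMap.injective_iff_surjective (f := (B + c • (1 - B) : Eu n →L[ℝ] Eu n).toLinearMap)).mp hinj⟩

theorem B_transfer {n : ℕ} {q : Eu n → EReal} (hq : ProperLscConvex q) {γ γ' : ℝ} (hγ : 0 < γ)
    (hγ' : 0 < γ') {p p' : Eu n → Eu n} (hp : IsProxOf q γ p) (hp' : IsProxOf q γ' p')
    {z : Eu n} {B : Eu n →L[ℝ] Eu n} (hB : B ∈ BSubdiff p' z) :
    ∃ T : Eu n →L[ℝ] Eu n, T = B + (γ' / γ) • (1 - B) ∧ IsUnit T ∧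
      B * Ring.inverse T ∈ BSubdiff p (p' z + (γ' / γ) • (z - p' z)) := by
  have hc : 0 < γ' / γ := div_pos hγ' hγ
  have hTu := T_unit hc (B_firm hq hγ' hp' hB)
  refine ⟨_, rfl, hTu, ?_⟩
  obtain ⟨u, V, hV, hu, hlim⟩ := hB
  have hcont' := prox_cont hq hγ' hp'
  have hcont := prox_cont hq hγ hp
  set c := γ' / γ with hcdef
  set ψ : Eu n → Eu n := fun u => p' u + c • (u - p' u) with hψ
  set φ : Eu n → Eu n := fun u => p u + c⁻¹ • (u - p u) with hφ
  have hpψ : ∀ u, p (ψ u) = p' u := fun u => by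
    have := prox_eq hq hγ hp (prox_sub hq hγ' hp' u)
    rw [← this]; congr 1
    simp only [hψ, this, smul_smul, hcdef]
    congr 2; field_simp
  have hpφ : ∀ u, p' (φ u) = p u := fun u => by
    have := prox_eq hq hγ' hp' (prox_sub hq hγ hp u)
    rw [← this]; congr 1
    simp only [hφ, this, smul_smul, hcdef]
    congr 2; field_simp
  have hψφ : ∀ u, ψ (φ u) = u := fun u => by
    simp only [hψ, hpφ]
    simp only [hφ, add_sub_cancel_left, smul_inv_smul₀ hc.ne', add_sub_cancel]
  have hφψ : ∀ u, φ (ψ u) = u := fun u => by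
    simp only [hφ, hpψ]
    simp only [hψ, add_sub_cancel_left, inv_smul_smul₀ hc.ne', add_sub_cancel]
  have hφc : Continuous φ := by simp only [hφ]; fun_prop
  have hψc : Continuous ψ := by simp only [hψ]; fun_prop
  refine ⟨fun k => ψ (u k), fun k => V k * Ring.inverse (V k + c • (1 - V k)), ?_,
    (hψc.tendsto z).comp hu, ?_⟩
  · intro k
    have hT := T_unit hc (deriv_firm hq hγ' hp' (hV k))
    have hd : HasFDerivAt ψ (V k + c • (1 - V k)) (u k) :=
      (hV k).add (((hasFDerivAt_id (u k)).sub (hV k)).const_smul c)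
    obtain ⟨U, hU⟩ := hT
    show HasFDerivAt p (V k * Ring.inverse (V k + c • (1 - V k))) (ψ (u k))
    rw [← hU] at hd ⊢
    rw [Ring.inverse_unit]
    have hd2 : HasFDerivAt φ ((↑U⁻¹ : Eu n →L[ℝ] Eu n)) (ψ (u k)) := by
      have := HasFDerivAt.of_local_left_inverse (f := ψ) (g := φ) (a := ψ (u k))
        (f' := ContinuousLinearEquiv.ofUnit U) hφc.continuousAt (by rw [hφψ]; exact hd)
        (Eventually.of_forall hψφ)
      exact this
    have : p = p' ∘ φ := by funext y; exact (hpφ y).symm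
    rw [this]
    exact HasFDerivAt.comp _ (by rw [hφψ]; exact hV k) hd2
  · obtain ⟨U, hU⟩ := hTu
    refine hlim.mul ?_
    rw [← hU]
    refine (NormedRing.inverse_continuousAt U).tendsto.comp ?_
    rw [hU]
    exact hlim.add ((tendsto_const_nhds.sub hlim).const_smul c)

theorem sqrt_le_add {a b : ℝ} (ha : 0 ≤ a) (hb : 0 ≤ b) : Real.sqrt (a ^ 2 + b ^ 2) ≤ a + b := by
  rw [Real.sqrt_le_left (by positivity)]
  nlinarith [mul_nonneg ha hb]

theorem F_small {n : ℕ} {F : Eu n → Eu n} (hF : ContDiff ℝ 1 F) (xbar : Eu n) {η : ℝ}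
    (hη : 0 < η) : ∃ δ > (0:ℝ), ∀ x, ‖x - xbar‖ ≤ δ →
      ‖fderiv ℝ F x (x - xbar) - F x + F xbar‖ ≤ η * ‖x - xbar‖ := by
  have h1 : HasFDerivAt F (fderiv ℝ F xbar) xbar :=
    (hF.differentiable one_ne_zero xbar).hasFDerivAt
  have h2 := h1.isLittleO.def (half_pos hη)
  have h3 : Continuous (fderiv ℝ F) := hF.continuous_fderiv one_ne_zero
  have h4 : ∀ᶠ x in 𝓝 xbar, ‖fderiv ℝ F x - fderiv ℝ F xbar‖ < η / 2 := by
    have := Metric.tendsto_nhds.mp (h3.tendsto xbar) (η / 2) (half_pos hη)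
    simpa [dist_eq_norm] using this
  obtain ⟨δ, hδ, h⟩ := Metric.eventually_nhds_iff.mp (h2.and h4)
  refine ⟨δ / 2, half_pos hδ, fun x hx => ?_⟩
  obtain ⟨e1, e2⟩ := h (y := x) (by rw [dist_eq_norm]; linarith)
  have e : fderiv ℝ F x (x - xbar) - F x + F xbar =
      (fderiv ℝ F x - fderiv ℝ F xbar) (x - xbar) -
        (F x - F xbar - fderiv ℝ F xbar (x - xbar)) := by
    simp only [_root_.sub_apply]; abel
  rw [e]
  have e3 := (fderiv ℝ F x - fderiv ℝ F xbar).le_opNorm (x - xbar)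
  have e4 := mul_le_mul_of_nonneg_right e2.le (norm_nonneg (x - xbar))
  refine (norm_sub_le _ _).trans ?_
  linarith

/-- Theorem 5.13: under SCD semismoothness* of `∂q` at `(x̄, −F(x̄))` and the
uniform regularity/boundedness condition, every sequence of the implementable SCD
semismooth* Newton method (Algorithm 6) is a sequence of the G-semismooth Newton iteration
(Algorithm 7) and converges locally superlinearly to `x̄`. -/
theorem stmt15 {n : ℕ} (q : Eu n → EReal) (hq : ProperLscConvex q)
    (P : ℝ → Eu n → Eu n) (hP : ∀ γ > (0:ℝ), IsProxOf q γ (P γ))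
    (F : Eu n → Eu n) (hF : ContDiff ℝ 1 F)
    (xbar : Eu n) (hsol : -F xbar ∈ subdiff q xbar)
    (r ℓ : ℝ) (hr : 0 < r) (hℓ : 0 ≤ ℓ)
    (hLip : ∀ x ∈ Metric.closedBall xbar r, ∀ y ∈ Metric.closedBall xbar r,
      ‖F x - F y‖ ≤ ℓ * ‖x - y‖)
    (γlo γhi : ℝ) (hγlo : 0 < γlo) (hγ : γlo ≤ γhi)
    (hH1 : ∀ γ ∈ Set.Icc γlo γhi, ∀ ε > (0:ℝ), ∃ δq > (0:ℝ),
      ∀ d dstar : Eu n, dstar ∈ subdiff q d →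
        Real.sqrt (‖d - xbar‖^2 + ‖dstar + F xbar‖^2) ≤ δq →
        ∀ B ∈ BSubdiff (P γ) (d + γ⁻¹ • dstar), ∀ v : Eu n,
          |⟪γ • (v - B v), d - xbar⟫ - ⟪B v, dstar + F xbar⟫| ≤
            ε / (2 * Real.sqrt 2 * (ℓ + 1)) *
              Real.sqrt (‖B v‖^2 + ‖γ • (v - B v)‖^2) *
              Real.sqrt (‖d - xbar‖^2 + ‖dstar + F xbar‖^2))
    (hreg : ∃ κ > (0:ℝ), ∃ ρ > (0:ℝ), ∀ γ ∈ Set.Icc γlo γhi, ∀ x : Eu n,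
      Real.sqrt (‖x - xbar‖^2 + ‖x + (P γ (x - γ⁻¹ • F x) - x) - xbar‖^2) ≤ ρ →
      ∀ B ∈ BSubdiff (P γ) (x - γ⁻¹ • F x),
        IsUnit (adjoint (fderiv ℝ F x) * B + γ • (1 - B)) ∧
        (∀ a b : Eu n,
          Real.sqrt
            (‖B ((Ring.inverse (adjoint (fderiv ℝ F x) * B + γ • (1 - B))) a) +
                B ((Ring.inverse (adjoint (fderiv ℝ F x) * B + γ • (1 - B))) b)‖^2 +
              ‖γ • (((1 - B : Eu n →L[ℝ] Eu n))
                  ((Ring.inverse (adjoint (fderiv ℝ F x) * B + γ • (1 - B))) a)) +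
                (γ • (((1 - B : Eu n →L[ℝ] Eu n))
                  ((Ring.inverse (adjoint (fderiv ℝ F x) * B + γ • (1 - B))) b)) - b)‖^2)
          ≤ κ * Real.sqrt (‖a‖^2 + ‖b‖^2))) :
    ∃ U ∈ 𝓝 xbar, ∀ x0 ∈ U, ∀ x : ℕ → Eu n, ∀ γk : ℕ → ℝ,
      ∀ Bk : ℕ → (Eu n →L[ℝ] Eu n), ∀ Wk : ℕ → (Eu n →L[ℝ] Eu n),
      x 0 = x0 → (∀ k, γk k ∈ Set.Icc γlo γhi) →
      (∀ k, Bk k ∈ BSubdiff (P (γk k)) (x k - (γk k)⁻¹ • F (x k))) →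
      (∀ k, Function.Bijective ⇑(Wk k)) →
      (∀ k, ((adjoint (Bk k * Wk k) * fderiv ℝ F (x k) +
            adjoint ((γk k) • (1 - Bk k) * Wk k) : Eu n →L[ℝ] Eu n)) (x (k+1) - x k)
          = (((γk k) • adjoint (Bk k * Wk k) +
            adjoint ((γk k) • (1 - Bk k) * Wk k) : Eu n →L[ℝ] Eu n))
              (P (γk k) (x k - (γk k)⁻¹ • F (x k)) - x k)) →
      ((∀ k, ((Bk k * (1 - (γk k)⁻¹ • fderiv ℝ F (x k)) - 1 : Eu n →L[ℝ] Eu n))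
            (x (k+1) - x k)
          = -(P (γk k) (x k - (γk k)⁻¹ • F (x k)) - x k)) ∧
        Tendsto x atTop (𝓝 xbar) ∧
        (fun k => ‖x (k+1) - xbar‖) =o[atTop] (fun k => ‖x k - xbar‖)) := by
  obtain ⟨κ, hκ, ρ, hρ, hreg⟩ := hreg
  have hγpos : ∀ γ ∈ Set.Icc γlo γhi, 0 < γ := fun γ h => hγlo.trans_le h.1
  have hγhi : 0 < γhi := hγlo.trans_le hγ
  have key : ∀ ε > (0:ℝ), ∃ δ > (0:ℝ), ∀ γ ∈ Set.Icc γlo γhi, ∀ x : Eu n, ‖x - xbar‖ ≤ δ →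
      ∀ B ∈ BSubdiff (P γ) (x - γ⁻¹ • F x), ∀ y : Eu n,
      (∀ v, ⟪B v, fderiv ℝ F x (y - x)⟫ + γ * ⟪v - B v, y - x⟫ =
        γ * ⟪v, P γ (x - γ⁻¹ • F x) - x⟫) →
      ‖y - xbar‖ ≤ ε * ‖x - xbar‖ := by
    intro ε hε
    set c1 : ℝ := 1 + ℓ / γlo with hc1
    have hc1p : 0 < c1 := by positivity
    set c2 : ℝ := γhi * (1 + c1) + ℓ with hc2
    have hc2p : 0 < c2 := by positivity
    set η : ℝ := ε / (κ * (c1 + c2 + 1)) with hηdef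
    have hη : 0 < η := by positivity
    have hD : 0 < 2 * Real.sqrt 2 * (ℓ + 1) := by positivity
    obtain ⟨δq, hδq, hH⟩ := hH1 γlo ⟨le_rfl, hγ⟩ (η * (2 * Real.sqrt 2 * (ℓ + 1))) (by positivity)
    rw [mul_div_assoc, div_self hD.ne', mul_one] at hH
    obtain ⟨δF, hδF, hFs⟩ := F_small hF xbar hη
    refine ⟨min (min δF r) (min (δq / (c1 + c2)) (ρ / (1 + c1))), by positivity, ?_⟩
    intro γ hγm x hx B hB y hy
    have hγp := hγpos γ hγm
    have hxF : ‖x - xbar‖ ≤ δF := hx.trans ((min_le_left _ _).trans (min_le_left _ _))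
    have hxr : ‖x - xbar‖ ≤ r := hx.trans ((min_le_left _ _).trans (min_le_right _ _))
    have hxq : ‖x - xbar‖ ≤ δq / (c1 + c2) :=
      hx.trans ((min_le_right _ _).trans (min_le_left _ _))
    have hxρ : ‖x - xbar‖ ≤ ρ / (1 + c1) :=
      hx.trans ((min_le_right _ _).trans (min_le_right _ _))
    rw [le_div_iff₀ (by positivity)] at hxq hxρ
    have hs := norm_nonneg (x - xbar)
    have hFl : ‖F x - F xbar‖ ≤ ℓ * ‖x - xbar‖ :=
      hLip x (by rwa [mem_closedBall, dist_eq_norm]) xbar (mem_closedBall_self hr.le)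
    have hPb : P γ (xbar - γ⁻¹ • F xbar) = xbar := by
      have := prox_eq hq hγp (hP γ hγp) hsol
      rwa [smul_neg, ← sub_eq_add_neg] at this
    set z := x - γ⁻¹ • F x with hz
    set d := P γ z with hd
    set ds := γ • (z - d) with hds
    have hdsub : ds ∈ subdiff q d := prox_sub hq hγp (hP γ hγp) z
    have hdse : ds = γ • (x - d) - F x := by
      rw [hds, hz, sub_right_comm, smul_sub, smul_inv_smul₀ hγp.ne']
    have hd1 : ‖d - xbar‖ ≤ c1 * ‖x - xbar‖ := by
      have h1 := prox_lip hq hγp (hP γ hγp) z (xbar - γ⁻¹ • F xbar)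
      rw [hPb] at h1
      have e : z - (xbar - γ⁻¹ • F xbar) = (x - xbar) - γ⁻¹ • (F x - F xbar) := by
        rw [hz]; module
      rw [e] at h1
      have h2 := h1.trans (norm_sub_le _ _)
      rw [norm_smul, Real.norm_eq_abs, abs_of_pos (inv_pos.mpr hγp)] at h2
      have h3 : γ⁻¹ * ‖F x - F xbar‖ ≤ γlo⁻¹ * (ℓ * ‖x - xbar‖) := by
        gcongr
        exact hγm.1
      have h4 : c1 * ‖x - xbar‖ = ‖x - xbar‖ + γlo⁻¹ * (ℓ * ‖x - xbar‖) := by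
        rw [hc1]; field_simp
      linarith
    have hd2 : ‖ds + F xbar‖ ≤ c2 * ‖x - xbar‖ := by
      have e : ds + F xbar = γ • ((x - xbar) - (d - xbar)) - (F x - F xbar) := by
        rw [hdse]; module
      rw [e]
      refine (norm_sub_le _ _).trans ?_
      rw [norm_smul, Real.norm_eq_abs, abs_of_pos hγp]
      have h1 : ‖(x - xbar) - (d - xbar)‖ ≤ (1 + c1) * ‖x - xbar‖ :=
        (norm_sub_le _ _).trans (by linarith)
      have h2 : γ * ‖(x - xbar) - (d - xbar)‖ ≤ γhi * ((1 + c1) * ‖x - xbar‖) := by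
        gcongr
        exact hγm.2
      rw [hc2]; linarith
    have hN : Real.sqrt (‖d - xbar‖^2 + ‖ds + F xbar‖^2) ≤ (c1 + c2) * ‖x - xbar‖ :=
      (sqrt_le_add (norm_nonneg _) (norm_nonneg _)).trans (by linarith)
    have hregx := hreg γ hγm x (by
      rw [add_sub_cancel]
      exact (sqrt_le_add (norm_nonneg _) (norm_nonneg _)).trans (by linarith)) B hB
    obtain ⟨hMu, hMb⟩ := hregx
    set M := adjoint (fderiv ℝ F x) * B + γ • (1 - B) with hM
    set a := y - xbar with ha
    set v := Ring.inverse M a with hv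
    have hMv : M v = a := by
      have := congrArg (fun T : Eu n →L[ℝ] Eu n => T a) (Ring.mul_inverse_cancel M hMu)
      simpa using this
    have hee : Real.sqrt (‖B v‖^2 + ‖γ • (v - B v)‖^2) ≤ κ * ‖a‖ := by
      have := hMb a 0
      simpa using this
    have hBe : ‖B v‖ ≤ κ * ‖a‖ := by
      refine le_trans ?_ hee
      apply Real.le_sqrt_of_sq_le
      nlinarith [sq_nonneg ‖γ • (v - B v)‖]
    -- the H1 estimate, transferred from γlo
    have hHv : |⟪γ • (v - B v), d - xbar⟫ - ⟪B v, ds + F xbar⟫| ≤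
        η * Real.sqrt (‖B v‖^2 + ‖γ • (v - B v)‖^2) *
          Real.sqrt (‖d - xbar‖^2 + ‖ds + F xbar‖^2) := by
      obtain ⟨T, hT, hTu, hTB⟩ := B_transfer hq hγlo hγp (hP γlo hγlo) (hP γ hγp) hB
      have e1 : P γ z + (γ / γlo) • (z - P γ z) = d + γlo⁻¹ • ds := by
        rw [hds, smul_smul, ← hd, div_eq_inv_mul]
      rw [e1] at hTB
      have h := hH d ds hdsub (hN.trans (by linarith)) _ hTB (T v)
      have e2 : (B * Ring.inverse T) (T v) = B v := by
        have := congrArg (fun S : Eu n →L[ℝ] Eu n => B (S v)) (Ring.inverse_mul_cancel T hTu)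
        simpa using this
      have e3 : γlo • (T v - B v) = γ • (v - B v) := by
        have : T v = B v + (γ / γlo) • (v - B v) := by rw [hT]; simp
        rw [this, add_sub_cancel_left, smul_smul, mul_div_cancel₀ _ hγlo.ne']
      rw [e2, e3] at h
      exact h
    have hid : ⟪M v, a⟫ = (⟪γ • (v - B v), d - xbar⟫ - ⟪B v, ds + F xbar⟫) +
        ⟪B v, fderiv ℝ F x (x - xbar) - F x + F xbar⟫ := by
      have h1 := hy v
      have e1 : M v = adjoint (fderiv ℝ F x) (B v) + γ • (v - B v) := by rw [hM]; simp
      have e2 : a = (y - x) + (x - xbar) := by rw [ha]; abel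
      have e3 : d - xbar = (d - x) + (x - xbar) := by abel
      have e4 : ds + F xbar = -(γ • (d - x)) - F x + F xbar := by rw [hdse]; module
      have e5 : ⟪v, d - x⟫ = ⟪v - B v, d - x⟫ + ⟪B v, d - x⟫ := by
        rw [← inner_add_left, sub_add_cancel]
      rw [e5] at h1
      rw [e1, inner_add_left, adjoint_inner_left, e2, e3, e4]
      simp only [map_add, inner_add_right, inner_sub_right, inner_neg_right,
        real_inner_smul_left, real_inner_smul_right]
      simp only [inner_sub_right (𝕜 := ℝ) (v - B v), inner_sub_right (𝕜 := ℝ) (B v)] at h1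
      linarith
    rw [hMv, real_inner_self_eq_norm_sq] at hid
    have hb1 : ‖a‖ ^ 2 ≤ η * (κ * ‖a‖) * ((c1 + c2) * ‖x - xbar‖) +
        κ * ‖a‖ * (η * ‖x - xbar‖) := by
      rw [hid]
      refine add_le_add ((le_abs_self _).trans (hHv.trans ?_))
        ((real_inner_le_norm _ _).trans ?_)
      · gcongr
      · gcongr
        exact hFs x hxF
    have hb2 : ‖a‖ ^ 2 ≤ ‖a‖ * (ε * ‖x - xbar‖) := by
      refine hb1.trans (le_of_eq ?_)
      have : η * (κ * (c1 + c2 + 1)) = ε := by rw [hηdef]; field_simp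
      rw [← this]; ring
    rcases (norm_nonneg a).eq_or_lt with h0 | h0
    · rw [← h0]; positivity
    · rw [sq] at hb2
      exact le_of_mul_le_mul_left hb2 h0
  obtain ⟨δ, hδ, hstep⟩ := key (1/2) (by norm_num)
  refine ⟨closedBall xbar δ, closedBall_mem_nhds _ hδ, ?_⟩
  intro x0 hx0 x γk Bk Wk hx0' hγk hBk hWk hN
  have hweak : ∀ k v, ⟪Bk k v, fderiv ℝ F (x k) (x (k+1) - x k)⟫ +
      γk k * ⟪v - Bk k v, x (k+1) - x k⟫ =
        γk k * ⟪v, P (γk k) (x k - (γk k)⁻¹ • F (x k)) - x k⟫ := by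
    intro k v
    obtain ⟨w, rfl⟩ := (hWk k).2 v
    have h := congrArg (fun t => ⟪w, t⟫) (hN k)
    simp only [_root_.add_apply, _root_.smul_apply, ContinuousLinearMap.mul_apply,
      inner_add_right, real_inner_smul_right, adjoint_inner_right, _root_.sub_apply,
      ContinuousLinearMap.one_apply, real_inner_smul_left] at h
    rw [h, ← mul_add, ← inner_add_left, add_sub_cancel]
  have hrate : ∀ k, ‖x k - xbar‖ ≤ (1/2) ^ k * δ := by
    intro k
    induction k with
    | zero => rw [hx0']; simpa [dist_eq_norm] using hx0
    | succ k ih =>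
      have hle : (1/2 : ℝ) ^ k * δ ≤ δ :=
        mul_le_of_le_one_left hδ.le (pow_le_one₀ (by norm_num) (by norm_num))
      have := hstep _ (hγk k) (x k) (ih.trans hle) _ (hBk k) (x (k+1)) (hweak k)
      rw [pow_succ]
      linarith
  have hlim : Tendsto x atTop (𝓝 xbar) := by
    rw [tendsto_iff_norm_sub_tendsto_zero]
    refine squeeze_zero (fun _ => norm_nonneg _) hrate ?_
    have := (tendsto_pow_atTop_nhds_zero_of_lt_one (r := (1/2 : ℝ)) (by norm_num)
      (by norm_num)).mul_const δ
    simpa using this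
  refine ⟨?_, hlim, ?_⟩
  · intro k
    have hγp := hγpos _ (hγk k)
    refine ext_inner_left ℝ fun v => ?_
    have h := hweak k v
    have hs := B_symm hq hγp (hP _ hγp) (hBk k) v
    simp only [_root_.sub_apply, ContinuousLinearMap.mul_apply, ContinuousLinearMap.one_apply,
      _root_.smul_apply]
    rw [inner_sub_right, ← hs, inner_sub_right, real_inner_smul_right, inner_neg_right]
    rw [inner_sub_left] at h
    have h' : ⟪v, P (γk k) (x k - (γk k)⁻¹ • F (x k)) - x k⟫ = (γk k)⁻¹ *
        (⟪Bk k v, fderiv ℝ F (x k) (x (k+1) - x k)⟫ +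
          γk k * (⟪v, x (k+1) - x k⟫ - ⟪Bk k v, x (k+1) - x k⟫)) := by
      rw [h, inv_mul_cancel_left₀ hγp.ne']
    rw [h', mul_add, inv_mul_cancel_left₀ hγp.ne']
    ring
  · rw [isLittleO_iff]
    intro c hc
    obtain ⟨δc, hδc, hsc⟩ := key c hc
    have := Metric.tendsto_nhds.mp hlim δc hδc
    filter_upwards [this] with k hk
    rw [dist_eq_norm] at hk
    rw [norm_norm, norm_norm]
    exact hsc _ (hγk k) (x k) hk.le _ (hBk k) (x (k+1)) (hweak k)
end
end
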